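/- arXiv:2604.14255 — 3 statements merged into one kernel-verified Lean document; each statement's English description precedes it below -/
import Mathlib

section
/- For all n, m ∈ ℕ ∪ {∞}, every countable C_{n,m}-homogeneous linear order is sp-homogeneous. -/
/- `sFun x` is the successor of `x` if it exists, and `x` otherwise. -/
open Classical in
noncomputable def sFun {L : Type*} [LinearOrder L] (x : L) : L :=
  if h : ∃ y, x ⋖ y then h.choose else x

/- `pFun x` is the predecessor of `x` if it exists, and `x` otherwise. -/
open Classical in
noncomputable def pFun {L : Type*} [LinearOrder L] (x : L) : L :=
  if h : ∃ y, y ⋖ x then h.choose else x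

/-- The closure of a set under the successor and predecessor functions. -/
def spClosure (L : Type*) [LinearOrder L] (A : Set L) : Set L :=
  ⋂₀ {B : Set L | A ⊆ B ∧ ∀ x ∈ B, sFun x ∈ B ∧ pFun x ∈ B}

/-- A linear order is sp-homogeneous if every order-preserving, `s`- and `p`-commuting
bijection between the sp-closures of two finite tuples that sends one tuple to the other
extends to an order-automorphism commuting with `s` and `p` and sending the one tuple
to the other. -/
def IsSPHomogeneous (L : Type*) [LinearOrder L] : Prop :=
  ∀ (n : ℕ) (a b : Fin n → L),
    (∃ g : L → L,
      Set.BijOn g (spClosure L (Set.range a)) (spClosure L (Set.range b)) ∧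
      (∀ x ∈ spClosure L (Set.range a), ∀ y ∈ spClosure L (Set.range a),
        (x < y ↔ g x < g y)) ∧
      (∀ x ∈ spClosure L (Set.range a), g (sFun x) = sFun (g x)) ∧
      (∀ x ∈ spClosure L (Set.range a), g (pFun x) = pFun (g x)) ∧
      (∀ i, g (a i) = b i)) →
    ∃ σ : L ≃o L, (∀ x, σ (sFun x) = sFun (σ x)) ∧ (∀ x, σ (pFun x) = pFun (σ x)) ∧
      ∀ i, σ (a i) = b i

/-- `HasSuccChain i x` : there is a chain `x = x₀ ⋖ x₁ ⋖ ⋯ ⋖ xᵢ` (x has at least `i`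
successors); this is the relation `S_i`. -/
def HasSuccChain {L : Type*} [LinearOrder L] : ℕ → L → Prop
  | 0, _ => True
  | (i+1), x => ∃ y, x ⋖ y ∧ HasSuccChain i y

/-- `HasPredChain i x` : there is a chain `xᵢ ⋖ ⋯ ⋖ x₁ ⋖ x₀ = x` (x has at least `i`
predecessors); this is the relation `P_i`. -/
def HasPredChain {L : Type*} [LinearOrder L] : ℕ → L → Prop
  | 0, _ => True
  | (i+1), x => ∃ y, y ⋖ x ∧ HasPredChain i y

/-- `AdjRel k x y` : `x < y` and exactly `k` elements lie strictly between them. -/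
def AdjRel {L : Type*} [LinearOrder L] (k : ℕ) (x y : L) : Prop :=
  x < y ∧ (Set.Ioo x y).Finite ∧ (Set.Ioo x y).ncard = k

/-- `L` is `C_{n,m}`-homogeneous: every bijection between two finite subsets of `L`
preserving (in both directions) the order, the relations `S_i` for `i < n`, `P_j` for
`j < m`, and `Adj_k` for `k < n + m` extends to an order-automorphism of `L`. -/
def CnmHomogeneous (n m : ℕ∞) (L : Type*) [LinearOrder L] : Prop :=
  ∀ (A : Finset L) (g : L → L), Set.InjOn g ↑A →
    (∀ x ∈ A, ∀ y ∈ A, (x < y ↔ g x < g y)) →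
    (∀ i : ℕ, (i : ℕ∞) < n → ∀ x ∈ A, (HasSuccChain i x ↔ HasSuccChain i (g x))) →
    (∀ j : ℕ, (j : ℕ∞) < m → ∀ x ∈ A, (HasPredChain j x ↔ HasPredChain j (g x))) →
    (∀ k : ℕ, (k : ℕ∞) < n + m → ∀ x ∈ A, ∀ y ∈ A,
      (AdjRel k x y ↔ AdjRel k (g x) (g y))) →
    ∃ σ : L ≃o L, ∀ x ∈ A, σ x = g x

section SuccPred

variable {L : Type*} [LinearOrder L] {x y c : L}

theorem CovBy.sFun_eq (h : x ⋖ y) : sFun x = y := by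
  have hex : ∃ y, x ⋖ y := ⟨y, h⟩
  rw [sFun, dif_pos hex]
  exact hex.choose_spec.unique_right h

theorem CovBy.pFun_eq (h : y ⋖ x) : pFun x = y := by
  have hex : ∃ y, y ⋖ x := ⟨y, h⟩
  rw [pFun, dif_pos hex]
  exact hex.choose_spec.unique_left h

theorem covBy_iff_sFun : x ⋖ y ↔ sFun x ≠ x ∧ sFun x = y := by
  refine ⟨fun h => ⟨h.sFun_eq ▸ h.ne', h.sFun_eq⟩, ?_⟩
  rintro ⟨hne, rfl⟩
  by_cases hex : ∃ y, x ⋖ y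
  · obtain ⟨y, hy⟩ := hex
    rwa [hy.sFun_eq]
  · exact absurd (dif_neg hex) hne

theorem covBy_iff_pFun : y ⋖ x ↔ pFun x ≠ x ∧ pFun x = y := by
  refine ⟨fun h => ⟨h.pFun_eq ▸ h.ne, h.pFun_eq⟩, ?_⟩
  rintro ⟨hne, rfl⟩
  by_cases hex : ∃ y, y ⋖ x
  · obtain ⟨y, hy⟩ := hex
    rwa [hy.pFun_eq]
  · exact absurd (dif_neg hex) hne

theorem hasSuccChain_succ_iff {i : ℕ} :
    HasSuccChain (i + 1) x ↔ sFun x ≠ x ∧ HasSuccChain i (sFun x) := by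
  simp only [HasSuccChain, covBy_iff_sFun, and_assoc, exists_and_left, exists_eq_left']

theorem hasPredChain_succ_iff {i : ℕ} :
    HasPredChain (i + 1) x ↔ pFun x ≠ x ∧ HasPredChain i (pFun x) := by
  simp only [HasPredChain, covBy_iff_pFun, and_assoc, exists_and_left, exists_eq_left']

theorem adjRel_zero_iff : AdjRel 0 x y ↔ sFun x ≠ x ∧ sFun x = y := by
  rw [← covBy_iff_sFun, covBy_iff_Ioo_eq]
  refine and_congr_right fun _ => ⟨fun h => (Set.ncard_eq_zero h.1).1 h.2, fun h => ?_⟩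
  simp [h]

theorem CovBy.Ioo_eq_insert (h : x ⋖ c) (hc : c < y) :
    Set.Ioo x y = insert c (Set.Ioo c y) := by
  ext z
  simp only [Set.mem_Ioo, Set.mem_insert_iff]
  constructor
  · rintro ⟨hxz, hzy⟩
    rcases (h.ge_of_gt hxz).eq_or_lt with hz | hz
    · exact .inl hz.symm
    · exact .inr ⟨hz, hzy⟩
  · rintro (rfl | ⟨hz, hzy⟩)
    · exact ⟨h.lt, hc⟩
    · exact ⟨h.lt.trans hz, hzy⟩

theorem CovBy.adjRel_succ_iff {k : ℕ} (h : x ⋖ c) (hc : c < y) :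
    AdjRel (k + 1) x y ↔ AdjRel k c y := by
  simp only [AdjRel, h.Ioo_eq_insert hc, Set.finite_insert, h.lt.trans hc, hc, true_and]
  refine and_congr_right fun hfin => ?_
  rw [Set.ncard_insert_of_notMem (by simp) hfin, Nat.add_right_cancel_iff]

theorem adjRel_succ_iff {k : ℕ} :
    AdjRel (k + 1) x y ↔ sFun x ≠ x ∧ AdjRel k (sFun x) y := by
  constructor
  · intro h
    obtain ⟨_, hfin, hcard⟩ := id h
    have hne : (Set.Ioo x y).Nonempty := by
      rw [← Set.ncard_pos hfin]
      omega
    obtain ⟨c, hc, hmin⟩ := Set.exists_min_image _ id hfin hne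
    have hcov : x ⋖ c :=
      ⟨hc.1, fun z hxz hzc => (hmin z ⟨hxz, hzc.trans hc.2⟩).not_gt hzc⟩
    rw [hcov.sFun_eq]
    exact ⟨hcov.ne', (hcov.adjRel_succ_iff hc.2).1 h⟩
  · rintro ⟨hne, h⟩
    exact ((covBy_iff_sFun.2 ⟨hne, rfl⟩).adjRel_succ_iff h.1).2 h

theorem OrderIso.map_sFun (σ : L ≃o L) (x : L) : σ (sFun x) = sFun (σ x) := by
  by_cases hex : ∃ y, x ⋖ y
  · obtain ⟨y, hy⟩ := hex
    rw [hy.sFun_eq, ((apply_covBy_apply_iff σ).2 hy).sFun_eq]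
  · have hex' : ¬ ∃ y, σ x ⋖ y := fun ⟨y, hy⟩ =>
      hex ⟨σ.symm y, (apply_covBy_apply_iff σ).1 (by simpa using hy)⟩
    rw [sFun, sFun, dif_neg hex, dif_neg hex']

theorem OrderIso.map_pFun (σ : L ≃o L) (x : L) : σ (pFun x) = pFun (σ x) := by
  by_cases hex : ∃ y, y ⋖ x
  · obtain ⟨y, hy⟩ := hex
    rw [hy.pFun_eq, ((apply_covBy_apply_iff σ).2 hy).pFun_eq]
  · have hex' : ¬ ∃ y, y ⋖ σ x := fun ⟨y, hy⟩ =>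
      hex ⟨σ.symm y, (apply_covBy_apply_iff σ).1 (by simpa using hy)⟩
    rw [pFun, pFun, dif_neg hex, dif_neg hex']

theorem subset_spClosure (A : Set L) : A ⊆ spClosure L A :=
  Set.subset_sInter fun _ hB => hB.1

theorem sFun_mem_spClosure {A : Set L} (hx : x ∈ spClosure L A) : sFun x ∈ spClosure L A :=
  Set.mem_sInter.2 fun B hB => (hB.2 x (Set.mem_sInter.1 hx B hB)).1

theorem pFun_mem_spClosure {A : Set L} (hx : x ∈ spClosure L A) : pFun x ∈ spClosure L A :=
  Set.mem_sInter.2 fun B hB => (hB.2 x (Set.mem_sInter.1 hx B hB)).2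

variable {C : Set L} {g : L → L}

theorem hasSuccChain_map_iff (hC : ∀ x ∈ C, sFun x ∈ C) (hinj : Set.InjOn g C)
    (hg : ∀ x ∈ C, g (sFun x) = sFun (g x)) (i : ℕ) (hx : x ∈ C) :
    HasSuccChain i x ↔ HasSuccChain i (g x) := by
  induction i generalizing x with
  | zero => rfl
  | succ i ih =>
    rw [hasSuccChain_succ_iff, hasSuccChain_succ_iff, ih (hC x hx), ← hg x hx,
      hinj.ne_iff (hC x hx) hx]

theorem hasPredChain_map_iff (hC : ∀ x ∈ C, pFun x ∈ C) (hinj : Set.InjOn g C)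
    (hg : ∀ x ∈ C, g (pFun x) = pFun (g x)) (i : ℕ) (hx : x ∈ C) :
    HasPredChain i x ↔ HasPredChain i (g x) := by
  induction i generalizing x with
  | zero => rfl
  | succ i ih =>
    rw [hasPredChain_succ_iff, hasPredChain_succ_iff, ih (hC x hx), ← hg x hx,
      hinj.ne_iff (hC x hx) hx]

theorem adjRel_map_iff (hC : ∀ x ∈ C, sFun x ∈ C) (hinj : Set.InjOn g C)
    (hg : ∀ x ∈ C, g (sFun x) = sFun (g x)) (k : ℕ) (hx : x ∈ C) (hy : y ∈ C) :
    AdjRel k x y ↔ AdjRel k (g x) (g y) := by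
  induction k generalizing x with
  | zero =>
    rw [adjRel_zero_iff, adjRel_zero_iff, ← hg x hx, hinj.ne_iff (hC x hx) hx,
      hinj.eq_iff (hC x hx) hy]
  | succ k ih =>
    rw [adjRel_succ_iff, adjRel_succ_iff, ih (hC x hx), ← hg x hx, hinj.ne_iff (hC x hx) hx]

end SuccPred

/-- For all `n, m ∈ ℕ ∪ {∞}`, every countable `C_{n,m}`-homogeneous linear order is
sp-homogeneous. -/
theorem stmt1 (n m : ℕ∞) (L : Type) [LinearOrder L] [Countable L]
    (h : CnmHomogeneous n m L) : IsSPHomogeneous L := by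
  rintro N a b ⟨g, hbij, hlt, hs, hp, hab⟩
  have hinj := hbij.injOn
  have hmem : ∀ x ∈ Finset.univ.image a, x ∈ spClosure L (Set.range a) := fun x hx =>
    subset_spClosure _ (by simpa using hx)
  obtain ⟨σ, hσ⟩ := h (Finset.univ.image a) g (hinj.mono hmem)
    (fun x hx y hy => hlt x (hmem x hx) y (hmem y hy))
    (fun i _ x hx => hasSuccChain_map_iff (fun _ => sFun_mem_spClosure) hinj hs i (hmem x hx))
    (fun i _ x hx => hasPredChain_map_iff (fun _ => pFun_mem_spClosure) hinj hp i (hmem x hx))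
    (fun k _ x hx y hy =>
      adjRel_map_iff (fun _ => sFun_mem_spClosure) hinj hs k (hmem x hx) (hmem y hy))
  exact ⟨σ, σ.map_sFun, σ.map_pFun, fun i => (hσ (a i) (by simp)).trans (hab i)⟩
end

section
/- As k → ∞, the ratio J(k)/L(k) converges to 1/(2 − Z) (= 1/W(e²) ≈ 0.6422007); in the limit, this is the proportion of homogeneous k-colored countable linear orders that use all k colors. -/
/-- `J 0 = 1` and `J (i+1) = 2(i+1) J i + ∑_{t=2}^{i+1} C(i+1, t) J (i+1−t)`. -/
def Jfun : ℕ → ℕ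
  | 0 => 1
  | (i+1) => 2 * (i+1) * Jfun i +
      (Finset.Icc 2 (i+1)).attach.sum (fun t => Nat.choose (i+1) t.1 * Jfun (i+1 - t.1))
decreasing_by
  · exact Nat.lt_succ_self i
  · have := Finset.mem_Icc.mp t.2; omega

/-- `L(k) = ∑_{i=0}^{k} C(k, i) J i`. -/
def Lfun (k : ℕ) : ℕ :=
  ∑ i ∈ Finset.range (k+1), Nat.choose k i * Jfun i

open Filter Finset Topology

/-- A renewal theorem for step distributions whose weights at least halve at each step and whose
first weight exceeds one half. -/
theorem exists_pos_tendsto_of_renewal {p b : ℕ → ℝ} (hp : HasSum p 1) (hp0 : ∀ i, 0 ≤ p i)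
    (hhalf : ∀ i, 2 * p (i + 1) ≤ p i) (hfirst : 1 / 2 < p 0) (hb0 : b 0 = 1)
    (hb : ∀ n, b (n + 1) = ∑ i ∈ range (n + 1), p i * b (n - i)) :
    (∀ n, |b n| ≤ 1) ∧ ∃ c, 0 < c ∧ Tendsto b atTop (𝓝 c) := by
  have hbound : ∀ n, 0 ≤ b n ∧ b n ≤ 1 := by
    intro n
    induction n using Nat.strong_induction_on with
    | _ n ih =>
      rcases n with _ | n
      · simp [hb0]
      · rw [hb]
        refine ⟨sum_nonneg fun i _ ↦ mul_nonneg (hp0 i) (ih _ (by omega)).1, ?_⟩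
        calc ∑ i ∈ range (n + 1), p i * b (n - i) ≤ ∑ i ∈ range (n + 1), p i :=
              sum_le_sum fun i _ ↦ mul_le_of_le_one_right (hp0 i) (ih _ (by omega)).2
          _ ≤ 1 := sum_le_hasSum _ (fun i _ ↦ hp0 i) hp
  refine ⟨fun n ↦ by rw [abs_of_nonneg (hbound n).1]; exact (hbound n).2, ?_⟩
  -- the tails of `p`
  set q : ℕ → ℝ := fun j ↦ 1 - ∑ i ∈ range j, p i with hq
  have hqsucc : ∀ j, q (j + 1) = q j - p j := fun j ↦ by
    simp only [hq, sum_range_succ]; ring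
  have hqzero : q 0 = 1 := by simp [hq]
  have hqnonneg : ∀ j, 0 ≤ q j := fun j ↦
    sub_nonneg.2 (sum_le_hasSum _ (fun i _ ↦ hp0 i) hp)
  have hqlim : Tendsto q atTop (𝓝 0) := by
    simpa [hq] using (tendsto_const_nhds (x := (1 : ℝ))).sub hp.tendsto_sum_nat
  have hqhalf : ∀ j, 2 * q (j + 1) ≤ q j := by
    have hanti : Antitone fun j ↦ q j - 2 * q (j + 1) := antitone_nat_of_succ_le fun j ↦ by
      have := hhalf j
      rw [hqsucc (j + 1), hqsucc j]
      linarith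
    have hlim : Tendsto (fun j ↦ q j - 2 * q (j + 1)) atTop (𝓝 0) := by
      simpa using hqlim.sub (((tendsto_add_atTop_iff_nat 1).2 hqlim).const_mul 2)
    intro j
    linarith [hanti.le_of_tendsto hlim j]
  set ρ : ℝ := 2 * q 1 with hρ
  have hρ1 : ρ < 1 := by rw [hρ, hqsucc 0, hqzero]; linarith
  have hqsum : ∀ N, ∑ i ∈ range N, q (i + 1) ≤ ρ := by
    have hsum : ∀ N, ∑ i ∈ range N, q (i + 1) ≤ ρ - 2 * q (N + 1) := by
      intro N
      induction N with
      | zero => simp [hρ]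
      | succ N ih =>
        rw [sum_range_succ]
        linarith [hqhalf (N + 1)]
    exact fun N ↦ (hsum N).trans (by linarith [hqnonneg (N + 1)])
  have hconv : ∀ n, ∑ j ∈ range (n + 1), q j * b (n - j) = 1 := by
    intro n
    induction n with
    | zero => simp [hqzero, hb0]
    | succ n ih =>
      rw [sum_range_succ', hqzero, one_mul, Nat.sub_zero, hb]
      simp only [Nat.add_sub_add_right, hqsucc, sub_mul, sum_sub_distrib, ih]
      ring
  have hlower : ∀ n, 1 - ρ ≤ b n := by
    intro n
    have h := hconv n
    rw [sum_range_succ', hqzero, one_mul, Nat.sub_zero] at h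
    have hle : ∑ i ∈ range n, q (i + 1) * b (n - (i + 1)) ≤ ∑ i ∈ range n, q (i + 1) :=
      sum_le_sum fun i _ ↦ mul_le_of_le_one_right (hqnonneg _) (hbound _).2
    linarith [hqsum n]
  -- the increments of `b` are absolutely summable
  set d : ℕ → ℝ := fun n ↦ n.casesOn 1 fun m ↦ b (m + 1) - b m with hd
  have hdb : ∀ n, ∑ i ∈ range (n + 1), d i = b n := by
    intro n
    induction n with
    | zero => simp [hd, hb0]
    | succ n ih => rw [sum_range_succ, ih]; simp [hd]
  have hdrec : ∀ n, d (n + 1) = -∑ i ∈ range (n + 1), q (i + 1) * d (n - i) := by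
    intro n
    have h₁ := hconv n
    have h₂ := hconv (n + 1)
    have hlast : ∑ i ∈ range (n + 1), q (i + 1) * d (n - i)
        = (∑ i ∈ range n, q (i + 1) * (b (n - i) - b (n - (i + 1)))) + q (n + 1) := by
      rw [sum_range_succ]
      congr 1
      · refine sum_congr rfl fun i hi ↦ ?_
        obtain ⟨m, hm⟩ : ∃ m, n = i + 1 + m := ⟨n - (i + 1), by have := mem_range.1 hi; omega⟩
        have e₁ : n - i = m + 1 := by omega
        have e₂ : n - (i + 1) = m := by omega
        simp [hd, e₁, e₂]
      · simp [hd]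
    rw [sum_range_succ', hqzero] at h₁
    rw [sum_range_succ', sum_range_succ, hqzero] at h₂
    simp only [Nat.add_sub_add_right, Nat.sub_self, hb0, Nat.sub_zero, one_mul, mul_one] at h₁ h₂
    rw [hlast]
    simp only [mul_sub, sum_sub_distrib, hd]
    linarith
  have hdsum : ∀ N, ∑ n ∈ range N, |d n| ≤ 1 / (1 - ρ) := by
    intro N
    have hstep : ∑ n ∈ range N, |d (n + 1)| ≤ ρ * ∑ n ∈ range N, |d n| := by
      calc ∑ n ∈ range N, |d (n + 1)|
          ≤ ∑ n ∈ range N, ∑ i ∈ range (n + 1), q (i + 1) * |d (n - i)| := by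
            refine sum_le_sum fun n _ ↦ ?_
            rw [hdrec, abs_neg]
            refine (abs_sum_le_sum_abs _ _).trans (sum_le_sum fun i _ ↦ ?_)
            rw [abs_mul, abs_of_nonneg (hqnonneg _)]
        _ = ∑ i ∈ range N, ∑ m ∈ range (N - i), q (i + 1) * |d m| :=
            sum_range_diag_flip N fun i m ↦ q (i + 1) * |d m|
        _ ≤ ∑ i ∈ range N, ∑ m ∈ range N, q (i + 1) * |d m| :=
            sum_le_sum fun i _ ↦ sum_le_sum_of_subset_of_nonneg
              (range_subset_range.2 (Nat.sub_le _ _))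
              fun m _ _ ↦ mul_nonneg (hqnonneg _) (abs_nonneg _)
        _ = (∑ i ∈ range N, q (i + 1)) * ∑ m ∈ range N, |d m| := by rw [sum_mul_sum]
        _ ≤ _ := mul_le_mul_of_nonneg_right (hqsum N) (sum_nonneg fun _ _ ↦ abs_nonneg _)
    have h₁ : ∑ n ∈ range (N + 1), |d n| = ∑ n ∈ range N, |d (n + 1)| + 1 := by
      rw [sum_range_succ']; simp [hd]
    rw [sum_range_succ] at h₁
    rw [le_div_iff₀ (by linarith)]
    linarith [abs_nonneg (d N)]
  have hdsummable : Summable d :=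
    (summable_of_sum_range_le (fun _ ↦ abs_nonneg _) hdsum).of_abs
  have hlim : Tendsto b atTop (𝓝 (∑' n, d n)) := by
    have := (tendsto_add_atTop_iff_nat 1).2 hdsummable.hasSum.tendsto_sum_nat
    simpa only [hdb] using this
  exact ⟨_, (sub_pos.2 hρ1).trans_le (ge_of_tendsto' hlim hlower), hlim⟩

/-- Convolving a bounded convergent sequence with a summable one multiplies the limit by the sum. -/
theorem tendsto_sum_range_mul_of_hasSum {w b : ℕ → ℝ} {s c : ℝ} (hw : HasSum w s)
    (hw0 : ∀ i, 0 ≤ w i) (hb : ∀ n, |b n| ≤ 1) (hlim : Tendsto b atTop (𝓝 c)) :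
    Tendsto (fun n ↦ ∑ i ∈ range (n + 1), w i * b (n - i)) atTop (𝓝 (s * c)) := by
  have h := tendsto_tsum_of_dominated_convergence (𝓕 := atTop)
    (f := fun n i ↦ if i ∈ range (n + 1) then w i * b (n - i) else 0)
    (g := fun i ↦ w i * c) hw.summable ?_ ?_
  · rw [tsum_mul_right, hw.tsum_eq] at h
    refine h.congr fun n ↦ ?_
    rw [tsum_eq_sum (s := range (n + 1)) fun i hi ↦ if_neg hi]
    exact sum_congr rfl fun i hi ↦ if_pos hi
  · intro i
    have hi : Tendsto (fun n ↦ w i * b (n - i)) atTop (𝓝 (w i * c)) :=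
      (hlim.comp (tendsto_sub_atTop_nat i)).const_mul _
    refine hi.congr' ?_
    filter_upwards [eventually_ge_atTop i] with n hn
    rw [if_pos (mem_range.2 (by omega))]
  · refine Eventually.of_forall fun n i ↦ ?_
    split_ifs
    · rw [Real.norm_eq_abs, abs_mul, abs_of_nonneg (hw0 i)]
      exact mul_le_of_le_one_right (hw0 i) (hb _)
    · simpa using hw0 i

theorem Jfun_succ (n : ℕ) :
    Jfun (n + 1) = (n + 1) * Jfun n
      + ∑ i ∈ range (n + 1), (n + 1).choose (i + 1) * Jfun (n - i) := by
  rw [Jfun, sum_attach (Icc 2 (n + 1)) fun t ↦ (n + 1).choose t * Jfun (n + 1 - t),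
    sum_range_succ']
  have : Icc 2 (n + 1) = Ico 2 (n + 2) := by ext; simp; omega
  rw [this, sum_Ico_eq_sum_range]
  simp only [Nat.add_sub_cancel, zero_add, Nat.choose_one_right, Nat.sub_zero]
  have hterm : ∀ i, (n + 1).choose (2 + i) * Jfun (n + 1 - (2 + i))
      = (n + 1).choose (i + 1 + 1) * Jfun (n - (i + 1)) := fun i ↦ by
    congr 2 <;> omega
  simp only [hterm]
  ring

theorem Lfun_eq (k : ℕ) : Lfun k = ∑ i ∈ range (k + 1), k.choose i * Jfun (k - i) := by
  rw [Lfun, ← sum_range_reflect]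
  refine sum_congr rfl fun i hi ↦ ?_
  have := mem_range.1 hi
  rw [show k + 1 - 1 - i = k - i by omega, Nat.choose_symm (by omega)]

theorem choose_mul_mul_pow_div_factorial {n i : ℕ} (h : i ≤ n) (x z : ℝ) :
    (n.choose i : ℝ) * x * z ^ n / n.factorial
      = z ^ i / i.factorial * (x * z ^ (n - i) / (n - i).factorial) := by
  rw [Nat.cast_choose ℝ h, ← pow_mul_pow_sub z h]
  have := Nat.factorial_ne_zero n
  field_simp

/-- Let `Z ∈ (0,1)` be the unique real with `Z + e^Z = 2`. Then
`J(k)/L(k) → 1/(2 − Z)` as `k → ∞`; in the limit, this is the proportion of homogeneous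
`k`-colored countable linear orders that use all `k` colors. -/
theorem stmt14 (Z : ℝ) (hZ : Z ∈ Set.Ioo (0 : ℝ) 1) (hZeq : Z + Real.exp Z = 2) :
    Filter.Tendsto (fun k : ℕ => (Jfun k : ℝ) / (Lfun k : ℝ))
      Filter.atTop (nhds (1 / (2 - Z))) := by
  obtain ⟨hZ0, hZ1⟩ := hZ
  have hZquarter : 1 / 4 < Z := by
    by_contra! hle
    have h₁ : (7 / 4 : ℝ) ≤ Real.exp Z := by linarith
    have h₂ : Real.exp Z ^ 4 ≤ Real.exp 1 := by
      rw [← Real.exp_nat_mul]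
      exact Real.exp_le_exp.2 (by push_cast; linarith)
    have h₃ : (7 / 4 : ℝ) ^ 4 ≤ Real.exp Z ^ 4 := by gcongr
    have := Real.exp_one_lt_d9
    norm_num at h₃
    linarith
  set b : ℕ → ℝ := fun n ↦ Jfun n * Z ^ n / n.factorial with hb
  set w : ℕ → ℝ := fun i ↦ Z ^ i / i.factorial with hw
  set p : ℕ → ℝ := fun i ↦ w (i + 1) + if i = 0 then Z else 0 with hp
  have hw0 : ∀ i, 0 ≤ w i := fun i ↦ by positivity
  have hwsum : HasSum w (Real.exp Z) := by
    rw [Real.exp_eq_exp_ℝ]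
    exact NormedSpace.expSeries_div_hasSum_exp Z
  have hpsum : HasSum p 1 := by
    have h₁ : HasSum (fun i ↦ w (i + 1)) (Real.exp Z - 1) := by
      simpa [hw] using (hasSum_nat_add_iff' 1).2 hwsum
    convert h₁.add (hasSum_ite_eq 0 Z) using 1
    linarith
  have hrec : ∀ n, b (n + 1) = ∑ i ∈ range (n + 1), p i * b (n - i) := by
    intro n
    have hextra : ∑ i ∈ range (n + 1), (if i = 0 then Z else 0) * b (n - i) = Z * b n := by
      simp [ite_mul]
    simp only [hp, add_mul, sum_add_distrib, hextra]
    simp only [hb, Jfun_succ]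
    push_cast
    rw [add_mul, add_div, sum_mul, sum_div, add_comm]
    congr 1
    · refine sum_congr rfl fun i hi ↦ ?_
      rw [choose_mul_mul_pow_div_factorial (by have := mem_range.1 hi; omega),
        Nat.add_sub_add_right]
    · rw [Nat.factorial_succ]
      push_cast
      field_simp
      ring
  obtain ⟨hbound, c, hc, hlim⟩ := exists_pos_tendsto_of_renewal hpsum
    (fun i ↦ add_nonneg (hw0 _) (by split_ifs <;> linarith))
    (fun i ↦ by
      have hstep : 2 * w (i + 2) ≤ w (i + 1) := by
        have hi : (0 : ℝ) ≤ i := i.cast_nonneg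
        have hsucc : w (i + 2) = w (i + 1) * (Z / (i + 2)) := by
          simp only [hw, Nat.factorial_succ (i + 1), pow_succ Z (i + 1)]
          push_cast
          field_simp
          ring
        have hratio : Z / (i + 2) ≤ 1 / 2 := by
          rw [div_le_div_iff₀ (by positivity) (by positivity)]
          linarith
        rw [hsucc]
        linarith [mul_le_mul_of_nonneg_left hratio (hw0 (i + 1))]
      have : 0 ≤ if i = 0 then Z else 0 := by split_ifs <;> linarith
      simp only [hp, Nat.add_eq_zero_iff, one_ne_zero, and_false, if_false]
      linarith)
    (by simp [hp, hw]; linarith) (by simp [hb, Jfun]) hrec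
  have hL : ∀ k, (Lfun k : ℝ) * Z ^ k / k.factorial
      = ∑ i ∈ range (k + 1), w i * b (k - i) := by
    intro k
    rw [Lfun_eq]
    push_cast
    rw [sum_mul, sum_div]
    exact sum_congr rfl fun i hi ↦
      choose_mul_mul_pow_div_factorial (by have := mem_range.1 hi; omega) _ _
  have hlimL := tendsto_sum_range_mul_of_hasSum hwsum hw0 hbound hlim
  have hratio := hlim.div hlimL (by positivity)
  have hval : c / (Real.exp Z * c) = 1 / (2 - Z) := by
    rw [← eq_sub_of_add_eq' hZeq]
    field_simp
  rw [hval] at hratio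
  refine hratio.congr fun k ↦ ?_
  have hpow : Z ^ k ≠ 0 := by positivity
  have hfac : (k.factorial : ℝ) ≠ 0 := by positivity
  rw [Pi.div_apply, ← hL, hb, div_div_div_cancel_right₀ hfac, mul_div_mul_right _ _ hpow]
end

section
/- There exists a constant C > 0 such that I(k) ≤ C·k!·(2.123)^k for every k ≥ 1; that is, I(k) = O(k!·2.123^k). -/
/-- `K12 i = (K₁ i, K₂ i)` where `K₁ 0 = 1`, `K₂ 0 = 0`,
`K₁ (i+1) = ∑_{j=0}^{i} C(i+1, j) (K₁ j + K₂ j)` and `K₂ (i+1) = (i+1) K₁ i`. -/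
def K12 : ℕ → ℕ × ℕ
  | 0 => (1, 0)
  | (i+1) =>
    ((Finset.range (i+1)).attach.sum
        (fun j => Nat.choose (i+1) j.1 * ((K12 j.1).1 + (K12 j.1).2)),
      (i+1) * (K12 i).1)
decreasing_by
  · exact Finset.mem_range.mp j.2
  · exact Nat.lt_succ_self i

/-- `I(k) = ∑_{i=0}^{k} (K₁ i + K₂ i) C(k, i)`. -/
def Ifun (k : ℕ) : ℕ :=
  ∑ i ∈ Finset.range (k+1), ((K12 i).1 + (K12 i).2) * Nat.choose k i

theorem K12_succ_fst (n : ℕ) :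
    (K12 (n + 1)).1 =
      ∑ j ∈ Finset.range (n + 1), (n + 1).choose j * ((K12 j).1 + (K12 j).2) := by
  rw [K12]
  exact Finset.sum_attach (Finset.range (n + 1))
    (fun j => (n + 1).choose j * ((K12 j).1 + (K12 j).2))

theorem K12_succ_snd (n : ℕ) : (K12 (n + 1)).2 = (n + 1) * (K12 n).1 := by
  rw [K12]

theorem exp_half_le : Real.exp (1 / 2) ≤ 5 / 3 := by
  have hsq : Real.exp (1 / 2) ^ 2 = Real.exp 1 := by
    rw [← Real.exp_nat_mul]
    norm_num
  have he := Real.exp_one_lt_d9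
  refine abs_le_of_sq_le_sq' ?_ (by norm_num) |>.2
  rw [hsq]
  linarith

theorem sum_choose_mul_factorial_mul_two_pow_le (n : ℕ) :
    ∑ j ∈ Finset.range (n + 1), (n.choose j : ℝ) * (j.factorial * 2 ^ j) ≤
      5 / 3 * (n.factorial * 2 ^ n) := by
  have hterm : ∀ j ∈ Finset.range (n + 1), (n.choose j : ℝ) * (j.factorial * 2 ^ j) =
      n.factorial * 2 ^ n * ((1 / 2) ^ (n - j) / (n - j).factorial) := by
    intro j hj
    have hjn : j ≤ n := Nat.lt_succ_iff.mp (Finset.mem_range.mp hj)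
    have hfac : (n.choose j : ℝ) * j.factorial * (n - j).factorial = n.factorial := by
      exact_mod_cast Nat.choose_mul_factorial_mul_factorial hjn
    have hpow : (2 : ℝ) ^ n = 2 ^ j * 2 ^ (n - j) := by
      rw [← pow_add, Nat.add_sub_cancel' hjn]
    have hne : ((n - j).factorial : ℝ) ≠ 0 := by positivity
    rw [← hfac, hpow, div_pow, one_pow]
    field_simp
  rw [Finset.sum_congr rfl hterm, ← Finset.mul_sum,
    Finset.sum_flip (fun m => (1 / 2 : ℝ) ^ m / m.factorial)]
  have hexp := (Real.sum_le_exp_of_nonneg (x := 1 / 2) (by norm_num) (n + 1)).trans exp_half_le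
  rw [mul_comm (5 / 3 : ℝ)]
  gcongr

theorem K12_add_le_of_fst_le (j : ℕ)
    (h : ∀ i ≤ j, ((K12 i).1 : ℝ) ≤ i.factorial * 2 ^ i) :
    ((K12 j).1 : ℝ) + (K12 j).2 ≤ 3 / 2 * (j.factorial * 2 ^ j) := by
  have hj := h j le_rfl
  cases j with
  | zero => norm_num [K12]
  | succ m =>
    have hm := mul_le_mul_of_nonneg_left (h m m.le_succ) (by positivity : (0 : ℝ) ≤ m + 1)
    rw [K12_succ_snd]
    rw [Nat.factorial_succ, pow_succ] at *
    push_cast at *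
    linarith

theorem K12_fst_le (n : ℕ) : ((K12 n).1 : ℝ) ≤ n.factorial * 2 ^ n := by
  induction n using Nat.strong_induction_on with
  | _ n ih =>
    cases n with
    | zero => norm_num [K12]
    | succ n =>
      have hsum := sum_choose_mul_factorial_mul_two_pow_le (n + 1)
      rw [Finset.sum_range_succ, Nat.choose_self, Nat.cast_one, one_mul] at hsum
      rw [K12_succ_fst]
      push_cast
      calc ∑ j ∈ Finset.range (n + 1), ((n + 1).choose j : ℝ) * ((K12 j).1 + (K12 j).2)
          ≤ ∑ j ∈ Finset.range (n + 1),
              ((n + 1).choose j : ℝ) * (3 / 2 * (j.factorial * 2 ^ j)) := by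
            gcongr with j hj
            exact K12_add_le_of_fst_le j fun i hi =>
              ih i (hi.trans_lt (Finset.mem_range.mp hj))
        _ = 3 / 2 * ∑ j ∈ Finset.range (n + 1),
              ((n + 1).choose j : ℝ) * (j.factorial * 2 ^ j) := by
            rw [Finset.mul_sum]
            exact Finset.sum_congr rfl fun j _ => by ring
        _ ≤ (n + 1).factorial * 2 ^ (n + 1) := by linarith

theorem Ifun_le (k : ℕ) : (Ifun k : ℝ) ≤ 5 / 2 * (k.factorial * 2 ^ k) := by
  unfold Ifun
  push_cast
  calc ∑ i ∈ Finset.range (k + 1), (((K12 i).1 : ℝ) + (K12 i).2) * k.choose i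
      ≤ ∑ i ∈ Finset.range (k + 1), 3 / 2 * (i.factorial * 2 ^ i : ℝ) * k.choose i := by
        gcongr with i
        exact K12_add_le_of_fst_le i fun m _ => K12_fst_le m
    _ = 3 / 2 * ∑ i ∈ Finset.range (k + 1), (k.choose i : ℝ) * (i.factorial * 2 ^ i) := by
        rw [Finset.mul_sum]
        exact Finset.sum_congr rfl fun i _ => by ring
    _ ≤ 5 / 2 * (k.factorial * 2 ^ k) := by
        linarith [sum_choose_mul_factorial_mul_two_pow_le k]

/-- There is a constant `C > 0` such that `I(k) ≤ C · k! · 2.123^k` for every `k ≥ 1`;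
that is, `I(k) = O(k! · 2.123^k)`. -/
theorem stmt15 :
    ∃ C : ℝ, 0 < C ∧ ∀ k : ℕ, 1 ≤ k →
      (Ifun k : ℝ) ≤ C * (Nat.factorial k : ℝ) * 2.123 ^ k := by
  refine ⟨5 / 2, by norm_num, fun k _ => (Ifun_le k).trans ?_⟩
  rw [← mul_assoc]
  gcongr
  norm_num
end
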